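/- Column space–null space duality for sparse knot sets: let k ≥ 0 and n ≥ k+2. Let H^k_n ∈ ℝ^{n×n} be the falling factorial basis matrix with entries (H^k_n)_{ij} = h^k_j(x_i), and let A^{k+1}_n = Z^{k+1}_n B^{k+1}_n ∈ ℝ^{n×n}. Let t_1 < ⋯ < t_r be knots with {t_1,…,t_r} ⊆ {x_{k+1},…,x_{n−1}}, write t_j = x_{i_j} for j = 1,…,r, and set J = {1,…,k+1} ∪ {i_j + 1 : j = 1,…,r}. Then the column space of the submatrix (H^k_n)_J ∈ ℝ^{n×(r+k+1)} (retaining the columns of H^k_n indexed by J) equals the null space of (A^{k+1}_n)_{J^c} (the submatrix retaining the rows of A^{k+1}_n indexed by the complement of J). -/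

import Mathlib

open Finset

/-- Divided difference of `f` with respect to a list of centers:
`f[z] = f z`, and `f[z₁,…,z_{r+1}] = (f[z₂,…,z_{r+1}] − f[z₁,…,z_r]) / (z_{r+1} − z₁)`. -/
noncomputable def divDiff (f : ℝ → ℝ) : List ℝ → ℝ
  | [] => 0
  | [z] => f z
  | z :: y :: l =>
      (divDiff f (y :: l) - divDiff f (z :: (y :: l).dropLast)) /
        ((y :: l).getLast (List.cons_ne_nil y l) - z)
  termination_by l => l.length
  decreasing_by
  · simp
  · simp [List.length_dropLast]

/-- The list of centers `x_lo, …, x_hi`. -/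
noncomputable def ctrs (x : ℕ → ℝ) (lo hi : ℕ) : List ℝ :=
  (List.range (hi + 1 - lo)).map fun m => x (lo + m)

/-- The index `i` such that `t ∈ (x_i, x_{i+1}]` (equals `0` when `t ≤ x 1`,
and `n` when `t > x n`): the number of design points strictly below `t`. -/
noncomputable def discrIdx (x : ℕ → ℝ) (n : ℕ) (t : ℝ) : ℕ :=
  ((Finset.Icc 1 n).filter fun i => x i < t).card

/-- The `k`-th order discrete derivative operator `Δ^k_n`. -/
noncomputable def discreteDeriv (x : ℕ → ℝ) (n k : ℕ) (f : ℝ → ℝ) (t : ℝ) : ℝ :=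
  let i := discrIdx x n t
  if k ≤ i then (Nat.factorial k : ℝ) * divDiff f (ctrs x (i + 1 - k) i ++ [t])
  else (Nat.factorial i : ℝ) * divDiff f (ctrs x 1 i ++ [t])

/-- The simple cumulative sum operator `S̄(·; x_{lo:n})`. -/
noncomputable def cumSum (x : ℕ → ℝ) (lo n : ℕ) (f : ℝ → ℝ) (t : ℝ) : ℝ :=
  (∑ j ∈ Finset.Icc lo n, if x j < t then f (x j) else 0) + f t

/-- The weight map `W^k_n`. -/
noncomputable def weightMap (x : ℕ → ℝ) (n k : ℕ) (f : ℝ → ℝ) (t : ℝ) : ℝ :=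
  let i := discrIdx x n t
  if k ≤ i then f t * ((t - x (i + 1 - k)) / k) else f t

/-- The `k`-th order discrete integral operator `S^k_n`:
`S^0 = id`, `S^1 = S̄(·;x_{1:n}) ∘ W^1_n`, and `S^k = S^{k-1} ∘ S̄(·;x_{k:n}) ∘ W^k_n`. -/
noncomputable def discreteInteg (x : ℕ → ℝ) (n : ℕ) : ℕ → (ℝ → ℝ) → ℝ → ℝ
  | 0, f => f
  | k + 1, f => discreteInteg x n k (cumSum x (k + 1) n (weightMap x n (k + 1) f))

/-- The `k`-th degree falling factorial basis function `h^k_j`. -/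
noncomputable def fallFact (x : ℕ → ℝ) (k j : ℕ) (t : ℝ) : ℝ :=
  if j ≤ k + 1 then
    (1 / (Nat.factorial (j - 1) : ℝ)) * ∏ ℓ ∈ Finset.Icc 1 (j - 1), (t - x ℓ)
  else
    (1 / (Nat.factorial k : ℝ)) * (∏ ℓ ∈ Finset.Icc (j - k) (j - 1), (t - x ℓ)) *
      (if x (j - 1) < t then 1 else 0)

/-- Membership in `H^k_n`, the span of the falling factorial basis, as functions on `[a,b]`. -/
def inFFSpan (x : ℕ → ℝ) (n k : ℕ) (a b : ℝ) (f : ℝ → ℝ) : Prop :=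
  ∃ c : ℕ → ℝ, ∀ t ∈ Set.Icc a b, f t = ∑ j ∈ Finset.Icc 1 n, c j * fallFact x k j t

/-- Divided difference of data `v_lo, …, v_{lo+d}` over centers `x_lo, …, x_{lo+d}`. -/
noncomputable def divDiffVec (x v : ℕ → ℝ) : ℕ → ℕ → ℝ
  | lo, 0 => v lo
  | lo, d + 1 => (divDiffVec x v (lo + 1) d - divDiffVec x v lo d) / (x (lo + d + 1) - x lo)

/-- Left derivative. -/
noncomputable def lDeriv (f : ℝ → ℝ) : ℝ → ℝ := fun t => derivWithin f (Set.Iic t) t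

/-- `k`-th derivative, taken as the left derivative where the derivative does not exist. -/
noncomputable def Dk (m : ℕ) (f : ℝ → ℝ) : ℝ → ℝ := lDeriv^[m] f

/-- The extended difference matrix `B̄_{n,k}` acting on vectors:
`(B̄_{n,k} v)_i = v_i` for `i ≤ k` and `v_i − v_{i−1}` for `i ≥ k+1`. -/
noncomputable def extDiff (k : ℕ) (v : ℕ → ℝ) : ℕ → ℝ :=
  fun i => if i ≤ k then v i else v i - v (i - 1)

/-- The inverse extended weight matrix `(Z^k_n)⁻¹` acting on vectors. -/
noncomputable def extWeightInv (x : ℕ → ℝ) (k : ℕ) (v : ℕ → ℝ) : ℕ → ℝ :=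
  fun i => if i ≤ k then v i else ((k : ℝ) / (x i - x (i - k))) * v i

/-- The extended weight matrix `Z^k_n` acting on vectors:
diagonal with entries `1` for `i ≤ k` and `(x_i − x_{i−k})/k` for `i ≥ k+1`. -/
noncomputable def extWeight (x : ℕ → ℝ) (k : ℕ) (v : ℕ → ℝ) : ℕ → ℝ :=
  fun i => if i ≤ k then v i else ((x i - x (i - k)) / k) * v i

/-- The extended `k`-th order discrete derivative matrix `B^k_n` acting on vectors:
`B^1_n = (Z^1_n)⁻¹ B̄_{n,1}`, `B^k_n = (Z^k_n)⁻¹ B̄_{n,k} B^{k−1}_n`. -/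
noncomputable def extDiscreteDeriv (x : ℕ → ℝ) : ℕ → (ℕ → ℝ) → ℕ → ℝ
  | 0, v => v
  | k + 1, v => extWeightInv x (k + 1) (extDiff (k + 1) (extDiscreteDeriv x k v))

/-! ### Linearity, locality and injectivity of the discrete derivative -/

/-- `A^{k+1}_n = B̄_{n,k+1} B^k_n` as a linear map on sequences. -/
noncomputable def diffDiscreteDeriv (x : ℕ → ℝ) (k : ℕ) : (ℕ → ℝ) →ₗ[ℝ] (ℕ → ℝ) where
  toFun v := extDiff (k + 1) (extDiscreteDeriv x k v)
  map_add' v w := by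
    have h : extDiscreteDeriv x k (v + w) = extDiscreteDeriv x k v + extDiscreteDeriv x k w := by
      induction k with
      | zero => rfl
      | succ k ih =>
        ext i
        simp only [extDiscreteDeriv, extWeightInv, extDiff, ih, Pi.add_apply]
        split_ifs <;> ring
    ext i
    simp only [extDiff, h, Pi.add_apply]
    split_ifs <;> ring
  map_smul' c v := by
    have h : extDiscreteDeriv x k (c • v) = c • extDiscreteDeriv x k v := by
      induction k with
      | zero => rfl
      | succ k ih =>
        ext i
        simp only [extDiscreteDeriv, extWeightInv, extDiff, ih, Pi.smul_apply, smul_eq_mul]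
        split_ifs <;> ring
    ext i
    simp only [extDiff, h, Pi.smul_apply, smul_eq_mul, RingHom.id_apply]
    split_ifs <;> ring

theorem diffDiscreteDeriv_apply (x : ℕ → ℝ) (k : ℕ) (v : ℕ → ℝ) (i : ℕ) :
    diffDiscreteDeriv x k v i = extDiff (k + 1) (extDiscreteDeriv x k v) i := rfl

theorem extDiscreteDeriv_succ_apply (x : ℕ → ℝ) (k : ℕ) (v : ℕ → ℝ) (i : ℕ) :
    extDiscreteDeriv x (k + 1) v i = extWeightInv x (k + 1) (diffDiscreteDeriv x k v) i := rfl

theorem lt_of_step_lt {x : ℕ → ℝ} {n : ℕ} (hmono : ∀ i, 1 ≤ i → i < n → x i < x (i + 1))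
    {i j : ℕ} (hi : 1 ≤ i) (hij : i < j) (hj : j ≤ n) : x i < x j := by
  induction j, hij using Nat.le_induction with
  | base => exact hmono i hi (by omega)
  | succ j hij ih => exact (ih (by omega)).trans (hmono j (by omega) (by omega))

theorem extWeight_extDiscreteDeriv {x : ℕ → ℝ} {n : ℕ}
    (hmono : ∀ i, 1 ≤ i → i < n → x i < x (i + 1)) (k : ℕ) (v : ℕ → ℝ) {i : ℕ} (hin : i ≤ n) :
    extWeight x (k + 1) (extDiscreteDeriv x (k + 1) v) i = diffDiscreteDeriv x k v i := by
  simp only [extWeight, extDiscreteDeriv_succ_apply, extWeightInv]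
  split_ifs with h
  · rfl
  · have := lt_of_step_lt hmono (i := i - (k + 1)) (j := i) (by omega) (by omega) hin
    have h1 : x i - x (i - (k + 1)) ≠ 0 := by linarith
    have h2 : ((k + 1 : ℕ) : ℝ) ≠ 0 := by positivity
    field_simp

theorem extDiff_congr {k i : ℕ} {v w : ℕ → ℝ} (hi : 1 ≤ i)
    (h : ∀ l, 1 ≤ l → l ≤ i → v l = w l) : extDiff (k + 1) v i = extDiff (k + 1) w i := by
  simp only [extDiff]
  split_ifs with hk
  · exact h i hi le_rfl
  · rw [h i hi le_rfl, h (i - 1) (by omega) (by omega)]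

theorem extDiscreteDeriv_congr {x : ℕ → ℝ} (k : ℕ) {i : ℕ} {v w : ℕ → ℝ} (hi : 1 ≤ i)
    (h : ∀ l, 1 ≤ l → l ≤ i → v l = w l) :
    extDiscreteDeriv x k v i = extDiscreteDeriv x k w i := by
  induction k generalizing i with
  | zero => exact h i hi le_rfl
  | succ k ih =>
    have := extDiff_congr (k := k) hi fun l hl hli => ih hl fun m hm hml => h m hm (hml.trans hli)
    simp only [extDiscreteDeriv, extWeightInv, this]

theorem diffDiscreteDeriv_congr {x : ℕ → ℝ} (k : ℕ) {i : ℕ} {v w : ℕ → ℝ} (hi : 1 ≤ i)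
    (h : ∀ l, 1 ≤ l → l ≤ i → v l = w l) :
    diffDiscreteDeriv x k v i = diffDiscreteDeriv x k w i :=
  extDiff_congr hi fun _ hl hli => extDiscreteDeriv_congr k hl fun m hm hml => h m hm (hml.trans hli)

theorem eq_zero_of_extDiff_eq_zero {k n : ℕ} {v : ℕ → ℝ}
    (h : ∀ i, 1 ≤ i → i ≤ n → extDiff (k + 1) v i = 0) : ∀ i, 1 ≤ i → i ≤ n → v i = 0 := by
  intro i
  induction i using Nat.strong_induction_on with
  | _ i ih =>
    intro hi hin
    have hv := h i hi hin
    simp only [extDiff] at hv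
    split_ifs at hv with hk
    · exact hv
    · rw [ih (i - 1) (by omega) (by omega) (by omega)] at hv
      linarith

theorem eq_zero_of_diffDiscreteDeriv_eq_zero {x : ℕ → ℝ} {n : ℕ}
    (hmono : ∀ i, 1 ≤ i → i < n → x i < x (i + 1)) (k : ℕ) {v : ℕ → ℝ}
    (h : ∀ i, 1 ≤ i → i ≤ n → diffDiscreteDeriv x k v i = 0) :
    ∀ i, 1 ≤ i → i ≤ n → v i = 0 := by
  induction k with
  | zero => exact eq_zero_of_extDiff_eq_zero h
  | succ k ih =>
    refine ih fun i hi hin => ?_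
    rw [← extWeight_extDiscreteDeriv hmono k v hin, extWeight,
      eq_zero_of_extDiff_eq_zero h i hi hin]
    simp

/-! ### The falling factorial basis at the design points -/

theorem fallFact_apply_of_le (x : ℕ → ℝ) {k j i : ℕ} (hi : 1 ≤ i) (hj : j ≤ k + 1) :
    fallFact x k j (x i) = if j ≤ i then
      (1 / (Nat.factorial (j - 1) : ℝ)) * ∏ l ∈ Finset.Icc 1 (j - 1), (x i - x l) else 0 := by
  rw [fallFact, if_pos hj]
  split_ifs with hji
  · rfl
  · rw [Finset.prod_eq_zero (i := i) (by simp; omega) (sub_self _), mul_zero]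

theorem fallFact_apply_of_ge {x : ℕ → ℝ} {n : ℕ}
    (hmono : ∀ i, 1 ≤ i → i < n → x i < x (i + 1)) {k j i : ℕ} (hi : 1 ≤ i) (hin : i ≤ n)
    (hj : k + 1 ≤ j) (hjn : j ≤ n + 1) :
    fallFact x k j (x i) = if j ≤ i then
      (1 / (Nat.factorial k : ℝ)) * ∏ l ∈ Finset.Icc (j - k) (j - 1), (x i - x l) else 0 := by
  rcases hj.eq_or_lt with rfl | hj
  · rw [fallFact_apply_of_le x hi le_rfl]
    simp
  · rw [fallFact, if_neg (by omega)]
    by_cases hji : j ≤ i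
    · rw [if_pos hji, if_pos (lt_of_step_lt hmono (by omega) (by omega) hin), mul_one]
    · rw [if_neg hji, if_neg, mul_zero]
      rcases (show i ≤ j - 1 by omega).eq_or_lt with h | h
      · rw [← h]; exact lt_irrefl _
      · exact (lt_of_step_lt hmono hi h (by omega)).le.not_gt

theorem fallFact_sub_fallFact_succ {x : ℕ → ℝ} {n : ℕ}
    (hmono : ∀ i, 1 ≤ i → i < n → x i < x (i + 1)) {k j i : ℕ} (hi : 1 ≤ i) (hin : i ≤ n)
    (hj : k + 2 ≤ j) (hjn : j ≤ n) :
    fallFact x (k + 1) j (x i) - fallFact x (k + 1) (j + 1) (x i) =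
      (x j - x (j - (k + 1))) / (k + 1 : ℕ) * fallFact x k j (x i) := by
  rw [fallFact_apply_of_ge hmono hi hin (by omega) (by omega),
    fallFact_apply_of_ge hmono hi hin (by omega) (by omega),
    fallFact_apply_of_ge hmono hi hin (by omega) (by omega)]
  by_cases hji : j ≤ i
  · have hlow : ∏ l ∈ Finset.Icc (j - (k + 1)) (j - 1), (x i - x l) =
        (x i - x (j - (k + 1))) * ∏ l ∈ Finset.Icc (j - k) (j - 1), (x i - x l) := by
      rw [← Finset.mul_prod_Ioc_eq_prod_Icc (by omega : j - (k + 1) ≤ j - 1)]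
      congr 2
      ext l; simp; omega
    have hhigh : ∏ l ∈ Finset.Icc (j + 1 - (k + 1)) (j + 1 - 1), (x i - x l) =
        (∏ l ∈ Finset.Icc (j - k) (j - 1), (x i - x l)) * (x i - x j) := by
      rw [Nat.add_sub_add_right, Nat.add_sub_cancel,
        ← Finset.prod_Ico_mul_eq_prod_Icc (by omega : j - k ≤ j)]
      congr 2
      ext l; simp; omega
    have hsucc : (if j + 1 ≤ i then (1 / (Nat.factorial (k + 1) : ℝ)) *
          ∏ l ∈ Finset.Icc (j + 1 - (k + 1)) (j + 1 - 1), (x i - x l) else 0) =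
        (1 / (Nat.factorial (k + 1) : ℝ)) *
          ((∏ l ∈ Finset.Icc (j - k) (j - 1), (x i - x l)) * (x i - x j)) := by
      rw [hhigh]
      split_ifs with h
      · rfl
      · obtain rfl : i = j := by omega
        simp
    rw [hsucc, if_pos hji, if_pos hji, hlow, Nat.factorial_succ]
    have : (Nat.factorial k : ℝ) ≠ 0 := by positivity
    push_cast
    field_simp
    ring
  · rw [if_neg hji, if_neg hji, if_neg (by omega)]
    simp

/-! ### Duality -/

theorem diffDiscreteDeriv_fallFact {x : ℕ → ℝ} {n : ℕ}
    (hmono : ∀ i, 1 ≤ i → i < n → x i < x (i + 1)) (k : ℕ) {i j : ℕ} (hi : 1 ≤ i) (hin : i ≤ n)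
    (hj : 1 ≤ j) (hjn : j ≤ n) :
    diffDiscreteDeriv x k (fun l => fallFact x k j (x l)) i = if i = j then 1 else 0 := by
  induction k generalizing i j with
  | zero =>
    have h : ∀ l, 1 ≤ l → l ≤ n → fallFact x 0 j (x l) = if j ≤ l then 1 else 0 := by
      intro l hl hln
      rw [fallFact_apply_of_ge hmono hl hln (by omega) (by omega)]
      have : Finset.Icc (j - 0) (j - 1) = ∅ := Finset.Icc_eq_empty (by omega)
      rw [this]
      simp
    simp only [diffDiscreteDeriv_apply, extDiff, extDiscreteDeriv]
    split_ifs with h1 h2 h2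
    · rw [h i hi hin, if_pos (by omega)]
    · rw [h i hi hin, if_neg (by omega)]
    · rw [h i hi hin, h (i - 1) (by omega) (by omega), if_pos (by omega), if_neg (by omega)]
      simp
    · rw [h i hi hin, h (i - 1) (by omega) (by omega)]
      split_ifs <;> first | omega | simp
  | succ k ih =>
    by_cases hjk : j ≤ k + 1
    · have hB : ∀ l, 1 ≤ l → l ≤ n →
          extDiscreteDeriv x (k + 1) (fun l => fallFact x (k + 1) j (x l)) l =
            if l = j then 1 else 0 := by
        intro l hl hln
        have hfun : (fun l => fallFact x (k + 1) j (x l)) = fun l => fallFact x k j (x l) := by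
          funext l
          simp only [fallFact, if_pos hjk, if_pos (show j ≤ k + 1 + 1 by omega)]
        rw [hfun, extDiscreteDeriv_succ_apply, extWeightInv, ih hl hln hj hjn]
        split_ifs <;> first | omega | simp
      simp only [diffDiscreteDeriv_apply, extDiff]
      split_ifs with h1 h2 h2
      · rw [hB i hi hin, if_pos h2]
      · rw [hB i hi hin, if_neg h2]
      · omega
      · rw [hB i hi hin, hB (i - 1) (by omega) (by omega), if_neg h2, if_neg (by omega), sub_zero]
    · have hD : ∀ l, 1 ≤ l → l ≤ n → ∀ m, m ≤ n + 1 → k + 2 ≤ m →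
          diffDiscreteDeriv x k (fun l => fallFact x (k + 1) m (x l)) l =
            if m ≤ l then (x l - x (l - (k + 1))) / (k + 1 : ℕ) else 0 := by
        intro l hl hln m hm
        induction hm using Nat.decreasingInduction with
        | self =>
          intro hm
          rw [if_neg (by omega), diffDiscreteDeriv_congr (w := 0) k hl, map_zero]
          · rfl
          · intro p hp hpl
            rw [fallFact_apply_of_ge hmono hp (by omega) (by omega) le_rfl, if_neg (by omega)]
            rfl
        | of_succ m hm ihm =>
          intro hkm
          have hrec := diffDiscreteDeriv_congr (x := x) k hl
            (v := (fun l => fallFact x (k + 1) m (x l)))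
            (w := (fun l => fallFact x (k + 1) (m + 1) (x l)) +
              ((x m - x (m - (k + 1))) / (k + 1 : ℕ)) • fun l => fallFact x k m (x l))
            (fun p hp hpl => by
              simp only [Pi.add_apply, Pi.smul_apply, smul_eq_mul]
              linarith [fallFact_sub_fallFact_succ hmono hp (hpl.trans hln) hkm (by omega)])
          rw [hrec, map_add, map_smul, Pi.add_apply, Pi.smul_apply, ihm (by omega),
            ih hl hln (by omega) (by omega)]
          by_cases hlm : l = m
          · subst hlm; simp
          · rw [if_neg hlm, smul_zero, add_zero]
            split_ifs <;> first | omega | rfl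
      have hB : ∀ l, 1 ≤ l → l ≤ n →
          extDiscreteDeriv x (k + 1) (fun l => fallFact x (k + 1) j (x l)) l =
            if j ≤ l then 1 else 0 := by
        intro l hl hln
        rw [extDiscreteDeriv_succ_apply, extWeightInv, hD l hl hln j (by omega) (by omega)]
        by_cases hjl : j ≤ l
        · have := lt_of_step_lt hmono (i := l - (k + 1)) (j := l) (by omega) (by omega) hln
          have h1 : x l - x (l - (k + 1)) ≠ 0 := by linarith
          have h2 : ((k + 1 : ℕ) : ℝ) ≠ 0 := by positivity
          rw [if_neg (by omega), if_pos hjl, if_pos hjl]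
          field_simp
        · simp [hjl]
      simp only [diffDiscreteDeriv_apply, extDiff]
      rw [hB i hi hin]
      split_ifs with h1 h2 h3 h2 h3
      all_goals first | omega | rfl | skip
      all_goals
        rw [hB (i - 1) (by omega) (by omega)]
        split_ifs <;> first | omega | simp

theorem diffDiscreteDeriv_sum_fallFact {x : ℕ → ℝ} {n : ℕ}
    (hmono : ∀ i, 1 ≤ i → i < n → x i < x (i + 1)) (k : ℕ) {J : Finset ℕ}
    (hJn : J ⊆ Finset.Icc 1 n) (c : ℕ → ℝ) {i : ℕ} (hi : 1 ≤ i) (hin : i ≤ n) :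
    diffDiscreteDeriv x k (∑ j ∈ J, c j • fun l => fallFact x k j (x l)) i =
      if i ∈ J then c i else 0 := by
  rw [map_sum, Finset.sum_apply, ← Finset.sum_ite_eq J i c]
  refine Finset.sum_congr rfl fun j hj => ?_
  have hj := Finset.mem_Icc.1 (hJn hj)
  rw [map_smul, Pi.smul_apply, diffDiscreteDeriv_fallFact hmono k hi hin hj.1 hj.2]
  simp

/-- Lemma: column space–null space duality for sparse knot sets.
With `A^{k+1}_n = Z^{k+1}_n B^{k+1}_n`, knots `t_j = x_{ι j}` (`k+1 ≤ ι j ≤ n−1`,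
strictly increasing), and `J = {1,…,k+1} ∪ {ι j + 1 : j = 1,…,r}`,
the column space of `(H^k_n)_J` equals the null space of `(A^{k+1}_n)_{J^c}`. -/
theorem colSpace_eq_nullSpace
    (n k r : ℕ) (a b : ℝ) (x : ℕ → ℝ)
    (hn : k + 2 ≤ n)
    (hmono : ∀ i, 1 ≤ i → i < n → x i < x (i + 1))
    (ha : a ≤ x 1) (hb : x n ≤ b) (hab : x (n + 1) = b)
    (ι : ℕ → ℕ)
    (hι1 : ∀ j ∈ Finset.Icc 1 r, k + 1 ≤ ι j ∧ ι j ≤ n - 1)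
    (hι2 : ∀ j j', 1 ≤ j → j < j' → j' ≤ r → ι j < ι j')
    (J : Finset ℕ)
    (hJ : J = Finset.Icc 1 (k + 1) ∪ (Finset.Icc 1 r).image (fun j => ι j + 1)) :
    ∀ v : ℕ → ℝ,
      (∃ c : ℕ → ℝ, ∀ i ∈ Finset.Icc 1 n,
        v i = ∑ j ∈ J, c j * fallFact x k j (x i)) ↔
      (∀ i ∈ Finset.Icc 1 n \ J, extWeight x (k + 1) (extDiscreteDeriv x (k + 1) v) i = 0) := by
  intro v
  have hJn : J ⊆ Finset.Icc 1 n := by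
    subst hJ
    intro j hj
    simp only [Finset.mem_union, Finset.mem_image] at hj
    rcases hj with hj | ⟨m, hm, rfl⟩
    · simp only [Finset.mem_Icc] at hj ⊢
      omega
    · have := hι1 m hm
      simp only [Finset.mem_Icc]
      omega
  constructor
  · rintro ⟨c, hc⟩ i hi
    obtain ⟨hi, hiJ⟩ := Finset.mem_sdiff.1 hi
    obtain ⟨hi, hin⟩ := Finset.mem_Icc.1 hi
    rw [extWeight_extDiscreteDeriv hmono k v hin,
      diffDiscreteDeriv_congr (w := ∑ j ∈ J, c j • fun l => fallFact x k j (x l)) k hi,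
      diffDiscreteDeriv_sum_fallFact hmono k hJn c hi hin, if_neg hiJ]
    intro l hl hli
    rw [hc l (Finset.mem_Icc.2 ⟨hl, hli.trans hin⟩)]
    simp
  · intro h
    refine ⟨diffDiscreteDeriv x k v, fun i hi => ?_⟩
    obtain ⟨hi, hin⟩ := Finset.mem_Icc.1 hi
    have hzero := eq_zero_of_diffDiscreteDeriv_eq_zero hmono k
      (v := v - ∑ j ∈ J, diffDiscreteDeriv x k v j • fun l => fallFact x k j (x l))
      (fun l hl hln => by
        rw [map_sub, Pi.sub_apply, diffDiscreteDeriv_sum_fallFact hmono k hJn _ hl hln]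
        split_ifs with hlJ
        · exact sub_self _
        · rw [sub_zero, ← extWeight_extDiscreteDeriv hmono k v hln]
          exact h l (Finset.mem_sdiff.2 ⟨Finset.mem_Icc.2 ⟨hl, hln⟩, hlJ⟩)) i hi hin
    rw [Pi.sub_apply, sub_eq_zero] at hzero
    rw [hzero]
    simp
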